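/- Let G be a 3-connected finite simple graph containing edges xy and x'y' whose four endpoints x, y, x', y' are pairwise distinct, such that at least three of the four pairs xx', xy', x'y, yy' are edges of G (i.e., the crossing of xy and x'y' is full or almost full). Let G' be the graph obtained from G by deleting the edges xy and x'y' and adding a new vertex v adjacent exactly to x, y, x', y'. If S is a 3-cut of G' with v ∉ S (so S consists of vertices of G), then S is a 3-cut of G. -/

import Mathlib

open SimpleGraph

/-- The graph obtained from `G` by deleting the edges `xy` and `x'y'` and adding a new
vertex (`none`) adjacent exactly to `x`, `y`, `x'`, `y'`. -/
def addCrossingVertex {V : Type*} (G : SimpleGraph V) (x y x' y' : V) :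
    SimpleGraph (Option V) :=
  SimpleGraph.map Function.Embedding.some (G.deleteEdges {s(x, y), s(x', y')}) ⊔
    SimpleGraph.fromEdgeSet {s((none : Option V), some x), s(none, some y),
      s(none, some x'), s(none, some y')}

/-- A graph is `k`-connected if it has more than `k` vertices and deleting any set of fewer
than `k` vertices leaves a connected graph. -/
def KConnected {V : Type*} [Fintype V] (k : ℕ) (G : SimpleGraph V) : Prop :=
  k < Fintype.card V ∧
    ∀ S : Finset V, S.card < k → (G.induce ((↑S : Set V)ᶜ)).Connected

theorem addCrossingVertex_adj_none {V : Type*} (G : SimpleGraph V) (x y x' y' w : V)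
    (hw : w = x ∨ w = y ∨ w = x' ∨ w = y') :
    (addCrossingVertex G x y x' y').Adj none (some w) := by
  simp only [addCrossingVertex, sup_adj, fromEdgeSet_adj]
  right
  rcases hw with rfl | rfl | rfl | rfl <;> simp

theorem addCrossingVertex_adj_some {V : Type*} (G : SimpleGraph V) (x y x' y' : V) {a b : V}
    (hab : G.Adj a b) (h : s(a, b) ≠ s(x, y)) (h' : s(a, b) ≠ s(x', y')) :
    (addCrossingVertex G x y x' y').Adj (some a) (some b) := by
  simp only [addCrossingVertex, sup_adj]
  left
  exact (SimpleGraph.map_adj _ _ _ _).2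
    ⟨a, b, by simp only [deleteEdges_adj, Set.mem_insert_iff, Set.mem_singleton_iff]; tauto,
      rfl, rfl⟩

/-- Deleting a set `S` of old vertices that misses one of the four ends of the crossing, the
graph with the crossing turned into a vertex stays connected if the original graph does. -/
theorem connected_induce_addCrossingVertex {V : Type*} [DecidableEq V] (G : SimpleGraph V)
    (x y x' y' : V) (S : Finset V)
    (hG : (G.induce ((↑S : Set V)ᶜ)).Connected) {w : V} (hwS : w ∉ S)
    (hw : w = x ∨ w = y ∨ w = x' ∨ w = y') :
    ((addCrossingVertex G x y x' y').induce
      ((↑(S.image some) : Set (Option V))ᶜ)).Connected := by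
  set T : Set (Option V) := (↑(S.image some) : Set (Option V))ᶜ with hT
  have hnone : (none : Option V) ∈ T := by simp [hT]
  have hsome (u : ((↑S : Set V)ᶜ : Set V)) : some u.1 ∈ T := by
    have h : u.1 ∉ (↑S : Set V) := u.2
    simpa [hT] using h
  have key (u : ((↑S : Set V)ᶜ : Set V)) (hu : u.1 = x ∨ u.1 = y ∨ u.1 = x' ∨ u.1 = y') :
      ((addCrossingVertex G x y x' y').induce T).Reachable ⟨none, hnone⟩ ⟨some u.1, hsome u⟩ :=
    Adj.reachable (addCrossingVertex_adj_none G x y x' y' u.1 hu)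
  have step (a b : ((↑S : Set V)ᶜ : Set V)) (hab : G.Adj a.1 b.1) :
      ((addCrossingVertex G x y x' y').induce T).Reachable
        ⟨some a.1, hsome a⟩ ⟨some b.1, hsome b⟩ := by
    by_cases h : s(a.1, b.1) = s(x, y) ∨ s(a.1, b.1) = s(x', y')
    · simp only [Sym2.eq_iff] at h
      exact (key a (by tauto)).symm.trans (key b (by tauto))
    · push Not at h
      exact Adj.reachable (addCrossingVertex_adj_some G x y x' y' hab h.1 h.2)
  have walk (a b : ((↑S : Set V)ᶜ : Set V)) (p : (G.induce ((↑S : Set V)ᶜ)).Walk a b) :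
      ((addCrossingVertex G x y x' y').induce T).Reachable
        ⟨some a.1, hsome a⟩ ⟨some b.1, hsome b⟩ := by
    induction p with
    | nil => exact Reachable.refl _
    | cons h _ ih => exact (step _ _ h).trans ih
  refine connected_iff_exists_forall_reachable _ |>.2 ⟨⟨none, hnone⟩, ?_⟩
  rintro ⟨_ | u, hu⟩
  · exact Reachable.refl _
  · have hu' : u ∈ (↑S : Set V)ᶜ := by simpa [hT] using hu
    obtain ⟨p⟩ := hG.preconnected ⟨w, by simpa using hwS⟩ ⟨u, hu'⟩
    exact (key ⟨w, by simpa using hwS⟩ hw).trans (walk _ _ p)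

/-- If `G` is 3-connected, the crossing of `xy` and `x'y'` is full or almost full, and `S` is
a 3-cut of the graph `G'` obtained by turning the crossing into a new 4-valent vertex `v` with
`v ∉ S` (so `S` consists of vertices of `G`), then `S` is a 3-cut of `G`. -/
theorem crossing_vertex_cut_of_old_vertices {V : Type*} [Fintype V] [DecidableEq V]
    (G : SimpleGraph V) (x y x' y' : V)
    (hxy : x ≠ y) (hxx' : x ≠ x') (hxy' : x ≠ y') (hyx' : y ≠ x') (hyy' : y ≠ y')
    (hx'y' : x' ≠ y')
    (e1 : G.Adj x y) (e2 : G.Adj x' y')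
    (hfull : (G.Adj x y' ∧ G.Adj x' y ∧ G.Adj y y') ∨
      (G.Adj x x' ∧ G.Adj x' y ∧ G.Adj y y') ∨
      (G.Adj x x' ∧ G.Adj x y' ∧ G.Adj y y') ∨
      (G.Adj x x' ∧ G.Adj x y' ∧ G.Adj x' y))
    (h3conn : KConnected 3 G)
    (S : Finset V) (hScard : S.card = 3)
    (hScut : ¬((addCrossingVertex G x y x' y').induce
      ((↑(S.image some) : Set (Option V))ᶜ)).Connected) :
    ¬(G.induce ((↑S : Set V)ᶜ)).Connected := by
  intro hG
  have hnot : ¬ ({x, y, x', y'} : Finset V) ⊆ S := fun hsub => by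
    have := Finset.card_le_card hsub
    have h4 : ({x, y, x', y'} : Finset V).card = 4 := by
      simp [hxy, hxx', hxy', hyx', hyy', hx'y']
    omega
  obtain ⟨w, hw, hwS⟩ := Finset.not_subset.1 hnot
  exact hScut (connected_induce_addCrossingVertex G x y x' y' S hG hwS (by simpa using hw))
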